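/- Action on principal symbols of half-integer contact order: let k = ℓ + 1/2 with ℓ ≥ 0 an integer, λ, μ ∈ ℂ, f ∈ A homogeneous, and F₁, F₂ ∈ A homogeneous of the same parity. Then 𝓛_{X_f}(F₁∂_x^ℓD̄₁ + F₂∂_x^ℓD̄₂) − (L^{μ−λ−k}_{X_f}(F₁) − (1/2)D̄₁D̄₂(f)·F₂)∂_x^ℓD̄₁ − (L^{μ−λ−k}_{X_f}(F₂) + (1/2)D̄₁D̄₂(f)·F₁)∂_x^ℓD̄₂ belongs to D^{k−1/2}_{λμ}; in particular the symbol action on the pair (F₁,F₂) is not componentwise but mixes the two components via the term (1/2)D̄₁D̄₂(f). -/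

import Mathlib

/-!
Functions on the supercircle `S^{1|2}`: the superalgebra
`A = C^∞(ℝ,ℂ)[ξ₁,ξ₂]`.  An element `f = f₀ + ξ₁f₁ + ξ₂f₂ + ξ₁ξ₂f₁₂`
is encoded by the 4-tuple `(f₀, f₁, f₂, f₁₂)` of functions `ℝ → ℂ`.
-/

noncomputable section

abbrev SA : Type := (ℝ → ℂ) × (ℝ → ℂ) × (ℝ → ℂ) × (ℝ → ℂ)

namespace SA

def a0 (f : SA) : ℝ → ℂ := f.1
def a1 (f : SA) : ℝ → ℂ := f.2.1
def a2 (f : SA) : ℝ → ℂ := f.2.2.1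
def a12 (f : SA) : ℝ → ℂ := f.2.2.2

/-- all four component functions are smooth -/
def Smooth (f : SA) : Prop :=
  ContDiff ℝ (⊤ : ℕ∞) (a0 f) ∧ ContDiff ℝ (⊤ : ℕ∞) (a1 f) ∧ ContDiff ℝ (⊤ : ℕ∞) (a2 f) ∧ ContDiff ℝ (⊤ : ℕ∞) (a12 f)

/-- the (super-commutative) product of the Grassmann algebra `A`;
`ξᵢ² = 0`, `ξ₁ξ₂ = -ξ₂ξ₁`. -/
def gmul (f g : SA) : SA :=
  (a0 f * a0 g,
   a0 f * a1 g + a1 f * a0 g,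
   a0 f * a2 g + a2 f * a0 g,
   a0 f * a12 g + a12 f * a0 g + a1 f * a2 g - a2 f * a1 g)

scoped infixl:70 " ⊙ " => SA.gmul

/-- the unit `1 ∈ A` -/
def one : SA := (1, 0, 0, 0)
/-- the even coordinate `x ∈ A` -/
def xx : SA := (fun t => (t : ℂ), 0, 0, 0)
/-- the odd coordinate `ξ₁ ∈ A` -/
def xi1 : SA := (0, 1, 0, 0)
/-- the odd coordinate `ξ₂ ∈ A` -/
def xi2 : SA := (0, 0, 1, 0)

/-- `∂_x`, differentiating the coefficients -/
def dx (f : SA) : SA := (deriv (a0 f), deriv (a1 f), deriv (a2 f), deriv (a12 f))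
/-- the left Grassmann derivative `∂_{ξ₁}` -/
def dxi1 (f : SA) : SA := (a1 f, 0, a12 f, 0)
/-- the left Grassmann derivative `∂_{ξ₂}` -/
def dxi2 (f : SA) : SA := (a2 f, -a12 f, 0, 0)
/-- `D̄₁ = ∂_{ξ₁} - ξ₁∂_x` -/
def D1 (f : SA) : SA := dxi1 f - xi1 ⊙ dx f
/-- `D̄₂ = ∂_{ξ₂} - ξ₂∂_x` -/
def D2 (f : SA) : SA := dxi2 f - xi2 ⊙ dx f

def IsEven (f : SA) : Prop := a1 f = 0 ∧ a2 f = 0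
def IsOdd (f : SA) : Prop := a0 f = 0 ∧ a12 f = 0
/-- `f` is homogeneous of parity `b` (`false` = even, `true` = odd) -/
def Homog (b : Bool) (f : SA) : Prop := if b then IsOdd f else IsEven f
/-- `(-1)^b` -/
def sgn (b : Bool) : ℂ := if b then -1 else 1
/-- `(-1)^(b*c)` -/
def sgn2 (b c : Bool) : ℂ := if b && c then -1 else 1

/-- the contact vector field `X_f` (with `f` homogeneous of parity `b`)
applied to `g`:  `X_f(g) = f ∂_x g - (-1)^{p(f)} ½ (D̄₁(f)D̄₁(g) + D̄₂(f)D̄₂(g))` -/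
def XV (b : Bool) (f : SA) (g : SA) : SA :=
  f ⊙ dx g - (sgn b * (2 : ℂ)⁻¹) • (D1 f ⊙ D1 g + D2 f ⊙ D2 g)

/-- the Lie derivative `L^λ_{X_f} = X_f + λ f'` on `λ`-densities -/
def Lden (b : Bool) (f : SA) (lam : ℂ) (g : SA) : SA :=
  XV b f g + lam • (dx f ⊙ g)

/-- the contact bracket `{f,g} = fg' - f'g - (-1)^{p(f)} ½ (D̄₁(f)D̄₁(g) + D̄₂(f)D̄₂(g))` -/
def cbr (b : Bool) (f g : SA) : SA :=
  f ⊙ dx g - dx f ⊙ g - (sgn b * (2 : ℂ)⁻¹) • (D1 f ⊙ D1 g + D2 f ⊙ D2 g)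

/-- the Lie derivative `𝓛_{X_f}(T) = L^μ_{X_f}∘T - (-1)^{p(f)p(T)} T∘L^λ_{X_f}`
of a homogeneous operator `T` of parity `bT` from `λ`- to `μ`-densities -/
def LieD (bf : Bool) (f : SA) (lam mu : ℂ) (bT : Bool) (T : SA → SA) : SA → SA :=
  fun g => Lden bf f mu (T g) - sgn2 bf bT • T (Lden bf f lam g)

def applyIf (b : Bool) (F : SA → SA) (g : SA) : SA := if b then F g else g

/-- the monomial operator `∂_x^ℓ D̄₁^m D̄₂^n` -/
def monoD (l : ℕ) (m n : Bool) (g : SA) : SA := dx^[l] (applyIf m D1 (applyIf n D2 g))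

def bnat (b : Bool) : ℕ := if b then 1 else 0

/-- membership in `D^{K/2}_{λμ}`: differential operators
`Σ a_{ℓ,m,n} ∂_x^ℓ D̄₁^m D̄₂^n` of contact order `ℓ + m/2 + n/2 ≤ K/2`. -/
def InD (K : ℕ) (T : SA → SA) : Prop :=
  ∃ a : ℕ → Bool → Bool → SA,
    (∀ l m n, Smooth (a l m n)) ∧
    (∀ l m n, ¬ (2 * l + bnat m + bnat n ≤ K) → a l m n = 0) ∧
    (∀ g, Smooth g →
      T g = ∑ l ∈ Finset.range (K + 1), ∑ m : Bool, ∑ n : Bool, a l m n ⊙ monoD l m n g)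

end SA

open SA

namespace SA

section Calculus

@[ext]
theorem ext_apply {f g : SA} (h0 : ∀ x, f.1 x = g.1 x) (h1 : ∀ x, f.2.1 x = g.2.1 x)
    (h2 : ∀ x, f.2.2.1 x = g.2.2.1 x) (h12 : ∀ x, f.2.2.2 x = g.2.2.2 x) : f = g :=
  Prod.ext (funext h0) (Prod.ext (funext h1) (Prod.ext (funext h2) (funext h12)))

theorem D1_eq (f : SA) : D1 f = (a1 f, -deriv (a0 f), a12 f, -deriv (a2 f)) := by
  ext x <;> simp [D1, dxi1, gmul, xi1, dx, a0, a1, a2, a12]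

theorem D2_eq (f : SA) : D2 f = (a2 f, -a12 f, -deriv (a0 f), deriv (a1 f)) := by
  ext x <;> simp [D2, dxi2, gmul, xi2, dx, a0, a1, a2, a12]

theorem dx_D1 (f : SA) : dx (D1 f) = D1 (dx f) := by
  ext x <;> simp [D1_eq, dx, a0, a1, a2, a12]

theorem dx_D2 (f : SA) : dx (D2 f) = D2 (dx f) := by
  ext x <;> simp [D2_eq, dx, a0, a1, a2, a12]

theorem iterate_dx_neg (l : ℕ) (f : SA) : dx^[l] (-f) = -dx^[l] f := by
  refine (Function.Commute.iterate_left (f := dx) (g := fun u => -u) (fun u => ?_) l) f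
  ext x <;> simp [dx, a0, a1, a2, a12]

theorem iterate_dx_D1 (l : ℕ) (f : SA) : dx^[l] (D1 f) = D1 (dx^[l] f) :=
  (Function.Commute.iterate_left dx_D1 l) f

theorem iterate_dx_D2 (l : ℕ) (f : SA) : dx^[l] (D2 f) = D2 (dx^[l] f) :=
  (Function.Commute.iterate_left dx_D2 l) f

theorem D1_D1 (f : SA) : D1 (D1 f) = -dx f := by
  ext x <;> simp [D1_eq, dx, a0, a1, a2, a12]

theorem D2_D2 (f : SA) : D2 (D2 f) = -dx f := by
  ext x <;> simp [D2_eq, dx, a0, a1, a2, a12]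

theorem D2_D1 (f : SA) : D2 (D1 f) = -D1 (D2 f) := by
  ext x <;> simp [D1_eq, D2_eq, a0, a1, a2, a12]

end Calculus

section Smoothness

theorem contDiff_deriv {u : ℝ → ℂ} (hu : ContDiff ℝ (⊤ : ℕ∞) u) :
    ContDiff ℝ (⊤ : ℕ∞) (deriv u) :=
  (contDiff_infty_iff_deriv.1 hu).2

variable {f g : SA}

theorem Smooth.add (hf : Smooth f) (hg : Smooth g) : Smooth (f + g) :=
  ⟨hf.1.add hg.1, hf.2.1.add hg.2.1, hf.2.2.1.add hg.2.2.1, hf.2.2.2.add hg.2.2.2⟩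

theorem Smooth.sub (hf : Smooth f) (hg : Smooth g) : Smooth (f - g) :=
  ⟨hf.1.sub hg.1, hf.2.1.sub hg.2.1, hf.2.2.1.sub hg.2.2.1, hf.2.2.2.sub hg.2.2.2⟩

theorem Smooth.smul (c : ℂ) (hf : Smooth f) : Smooth (c • f) :=
  ⟨hf.1.const_smul c, hf.2.1.const_smul c, hf.2.2.1.const_smul c, hf.2.2.2.const_smul c⟩

theorem smooth_zero : Smooth 0 :=
  ⟨contDiff_const, contDiff_const, contDiff_const, contDiff_const⟩

theorem Smooth.gmul (hf : Smooth f) (hg : Smooth g) : Smooth (f ⊙ g) := by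
  obtain ⟨p0, p1, p2, p12⟩ := hf
  obtain ⟨q0, q1, q2, q12⟩ := hg
  exact ⟨p0.mul q0, (p0.mul q1).add (p1.mul q0), (p0.mul q2).add (p2.mul q0),
    (((p0.mul q12).add (p12.mul q0)).add (p1.mul q2)).sub (p2.mul q1)⟩

theorem Smooth.dx (hf : Smooth f) : Smooth (dx f) :=
  ⟨contDiff_deriv hf.1, contDiff_deriv hf.2.1, contDiff_deriv hf.2.2.1, contDiff_deriv hf.2.2.2⟩

theorem Smooth.D1 (hf : Smooth f) : Smooth (D1 f) := by
  rw [D1_eq]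
  exact ⟨hf.2.1, (contDiff_deriv hf.1).neg, hf.2.2.2, (contDiff_deriv hf.2.2.1).neg⟩

theorem Smooth.D2 (hf : Smooth f) : Smooth (D2 f) := by
  rw [D2_eq]
  exact ⟨hf.2.2.1, hf.2.2.2.neg, (contDiff_deriv hf.1).neg, contDiff_deriv hf.2.1⟩

theorem Smooth.iterate_dx (l : ℕ) (hf : Smooth f) : Smooth (SA.dx^[l] f) := by
  induction l with
  | zero => exact hf
  | succ l ih => rw [Function.iterate_succ_apply']; exact ih.dx

theorem Smooth.monoD (l : ℕ) (m n : Bool) (hf : Smooth f) : Smooth (monoD l m n f) := by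
  refine Smooth.iterate_dx l ?_
  cases m <;> cases n <;> simp only [applyIf, if_true, Bool.false_eq_true, if_false]
  exacts [hf, hf.D2, hf.D1, hf.D2.D1]

theorem Smooth.Lden (b : Bool) (c : ℂ) (hf : Smooth f) (hg : Smooth g) :
    Smooth (Lden b f c g) :=
  ((hf.gmul hg.dx).sub (((hf.D1.gmul hg.D1).add (hf.D2.gmul hg.D2)).smul _)).add
    ((hf.dx.gmul hg).smul _)

/-- The components of a smooth element are differentiable. -/
theorem Smooth.differentiable (hf : Smooth f) :
    Differentiable ℝ f.1 ∧ Differentiable ℝ f.2.1 ∧ Differentiable ℝ f.2.2.1 ∧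
      Differentiable ℝ f.2.2.2 :=
  ⟨hf.1.differentiable (by simp), hf.2.1.differentiable (by simp),
    hf.2.2.1.differentiable (by simp), hf.2.2.2.differentiable (by simp)⟩

theorem dx_add (hf : Smooth f) (hg : Smooth g) : dx (f + g) = dx f + dx g := by
  obtain ⟨p0, p1, p2, p12⟩ := hf.differentiable
  obtain ⟨q0, q1, q2, q12⟩ := hg.differentiable
  ext x
  exacts [deriv_add (p0 x) (q0 x), deriv_add (p1 x) (q1 x), deriv_add (p2 x) (q2 x),
    deriv_add (p12 x) (q12 x)]

theorem dx_smul (c : ℂ) (hf : Smooth f) : dx (c • f) = c • dx f := by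
  obtain ⟨p0, p1, p2, p12⟩ := hf.differentiable
  ext x
  exacts [deriv_const_smul c (p0 x), deriv_const_smul c (p1 x), deriv_const_smul c (p2 x),
    deriv_const_smul c (p12 x)]

theorem dx_sub (hf : Smooth f) (hg : Smooth g) : dx (f - g) = dx f - dx g := by
  rw [sub_eq_add_neg, ← neg_one_smul ℂ g, dx_add hf (hg.smul _), dx_smul _ hg, neg_one_smul,
    sub_eq_add_neg]

theorem deriv_mul_apply {u v : ℝ → ℂ} (hu : Differentiable ℝ u) (hv : Differentiable ℝ v) (x : ℝ) :
    deriv (u * v) x = deriv u x * v x + u x * deriv v x :=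
  deriv_mul (hu x) (hv x)

theorem dx_gmul (hf : Smooth f) (hg : Smooth g) : dx (f ⊙ g) = dx f ⊙ g + f ⊙ dx g := by
  obtain ⟨p0, p1, p2, p12⟩ := hf.differentiable
  obtain ⟨q0, q1, q2, q12⟩ := hg.differentiable
  ext x <;> simp only [dx, SA.gmul, a0, a1, a2, a12, Prod.fst_add, Prod.snd_add, Pi.add_apply,
    Pi.mul_apply, Pi.sub_apply]
  · rw [deriv_mul_apply p0 q0]
  · rw [deriv_add ((p0.mul q1) x) ((p1.mul q0) x), deriv_mul_apply p0 q1, deriv_mul_apply p1 q0]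
    ring
  · rw [deriv_add ((p0.mul q2) x) ((p2.mul q0) x), deriv_mul_apply p0 q2, deriv_mul_apply p2 q0]
    ring
  · rw [deriv_sub ((((p0.mul q12).add (p12.mul q0)).add (p1.mul q2)) x) ((p2.mul q1) x),
      deriv_add (((p0.mul q12).add (p12.mul q0)) x) ((p1.mul q2) x),
      deriv_add ((p0.mul q12) x) ((p12.mul q0) x), deriv_mul_apply p0 q12,
      deriv_mul_apply p12 q0, deriv_mul_apply p1 q2, deriv_mul_apply p2 q1]
    ring

theorem dx_sum {ι : Type*} (s : Finset ι) (F : ι → SA) (hF : ∀ i, Smooth (F i)) :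
    Smooth (∑ i ∈ s, F i) ∧ dx (∑ i ∈ s, F i) = ∑ i ∈ s, dx (F i) := by
  classical
  induction s using Finset.induction_on with
  | empty =>
    refine ⟨smooth_zero, ?_⟩
    ext x <;> simp [dx, a0, a1, a2, a12]
  | insert i s hi ih =>
    simp only [Finset.sum_insert hi]
    exact ⟨(hF i).add ih.1, by rw [dx_add (hF i) ih.1, ih.2]⟩

end Smoothness

section Algebra

variable (f g h : SA) (c : ℂ)

theorem gmul_add : f ⊙ (g + h) = f ⊙ g + f ⊙ h := by
  ext x <;> simp [gmul, a0, a1, a2, a12] <;> ring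

theorem add_gmul : (f + g) ⊙ h = f ⊙ h + g ⊙ h := by
  ext x <;> simp [gmul, a0, a1, a2, a12] <;> ring

theorem gmul_smul : f ⊙ (c • g) = c • (f ⊙ g) := by
  ext x <;> simp [gmul, a0, a1, a2, a12] <;> ring

theorem smul_gmul : (c • f) ⊙ g = c • (f ⊙ g) := by
  ext x <;> simp [gmul, a0, a1, a2, a12] <;> ring

theorem gmul_neg : f ⊙ (-g) = -(f ⊙ g) := by
  rw [← neg_one_smul ℂ g, gmul_smul, neg_one_smul]

theorem gmul_sub : f ⊙ (g - h) = f ⊙ g - f ⊙ h := by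
  rw [sub_eq_add_neg, gmul_add, gmul_neg, sub_eq_add_neg]

theorem sub_gmul : (f - g) ⊙ h = f ⊙ h - g ⊙ h := by
  rw [sub_eq_add_neg, add_gmul, ← neg_one_smul ℂ g, smul_gmul, neg_one_smul, sub_eq_add_neg]

theorem gmul_assoc : f ⊙ g ⊙ h = f ⊙ (g ⊙ h) := by
  ext x <;> simp [gmul, a0, a1, a2, a12] <;> ring

theorem zero_gmul : (0 : SA) ⊙ g = 0 := by
  ext x <;> simp [gmul, a0, a1, a2, a12]

theorem gmul_sum {ι : Type*} (s : Finset ι) (F : ι → SA) :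
    f ⊙ ∑ i ∈ s, F i = ∑ i ∈ s, f ⊙ F i :=
  map_sum (AddMonoidHom.mk' (fun u => f ⊙ u) (gmul_add f)) F s

variable {f g}

theorem gmul_comm {b c : Bool} (hf : Homog b f) (hg : Homog c g) :
    g ⊙ f = sgn2 b c • (f ⊙ g) := by
  obtain ⟨f0, f1, f2, f12⟩ := f
  obtain ⟨g0, g1, g2, g12⟩ := g
  cases b <;> cases c <;> simp [Homog, IsEven, IsOdd, a0, a1, a2, a12] at hf hg <;>
    obtain ⟨rfl, rfl⟩ := hf <;> obtain ⟨rfl, rfl⟩ := hg <;>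
    ext x <;> simp [gmul, sgn2, a0, a1, a2, a12] <;> ring

theorem Homog.D1 {b : Bool} (hf : Homog b f) : Homog (!b) (D1 f) := by
  cases b <;> simp [Homog, IsEven, IsOdd, D1_eq, a0, a1, a2, a12] at hf ⊢ <;> simp [hf]

theorem Homog.D2 {b : Bool} (hf : Homog b f) : Homog (!b) (D2 f) := by
  cases b <;> simp [Homog, IsEven, IsOdd, D2_eq, a0, a1, a2, a12] at hf ⊢ <;> simp [hf]

theorem Homog.dx {b : Bool} (hf : Homog b f) : Homog b (dx f) := by
  have h := hf.D1.D1
  rw [D1_D1, Bool.not_not] at h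
  cases b <;> simpa [Homog, IsEven, IsOdd, a0, a1, a2, a12, SA.dx] using h

end Algebra

section Contact

variable {b : Bool} {f : SA}

/-- `D̄₁` is an odd derivation. -/
theorem D1_gmul {F u : SA} (hF : Homog b F) (sF : Smooth F) (su : Smooth u) :
    D1 (F ⊙ u) = D1 F ⊙ u + sgn b • (F ⊙ D1 u) := by
  have e := dx_gmul sF su
  have e0 := congrFun (congrArg a0 e)
  have e2 := congrFun (congrArg a2 e)
  cases b <;> simp [Homog, IsEven, IsOdd, a0, a1, a2, a12] at hF <;>
    ext x <;> have e0 := e0 x <;> have e2 := e2 x <;>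
    simp [D1_eq, dx, gmul, sgn, a0, a1, a2, a12, hF] at e0 e2 ⊢ <;> (try rw [e0]) <;>
    (try rw [e2]) <;> ring

/-- `D̄₂` is an odd derivation. -/
theorem D2_gmul {F u : SA} (hF : Homog b F) (sF : Smooth F) (su : Smooth u) :
    D2 (F ⊙ u) = D2 F ⊙ u + sgn b • (F ⊙ D2 u) := by
  have e := dx_gmul sF su
  have e0 := congrFun (congrArg a0 e)
  have e1 := congrFun (congrArg a1 e)
  cases b <;> simp [Homog, IsEven, IsOdd, a0, a1, a2, a12] at hF <;>
    ext x <;> have e0 := e0 x <;> have e1 := e1 x <;>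
    simp [D2_eq, dx, gmul, sgn, a0, a1, a2, a12, hF] at e0 e1 ⊢ <;> (try rw [e0]) <;>
    (try rw [e1]) <;> ring

theorem D1_add {f g : SA} (hf : Smooth f) (hg : Smooth g) : D1 (f + g) = D1 f + D1 g := by
  ext x <;> simp [D1, dx_add hf hg, dxi1, gmul, a0, a1, a2, a12] <;> ring

theorem D2_add {f g : SA} (hf : Smooth f) (hg : Smooth g) : D2 (f + g) = D2 f + D2 g := by
  ext x <;> simp [D2, dx_add hf hg, dxi2, gmul, a0, a1, a2, a12] <;> ring

theorem D1_smul {f : SA} (c : ℂ) (hf : Smooth f) : D1 (c • f) = c • D1 f := by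
  ext x <;> simp [D1, dx_smul c hf, dxi1, gmul, a0, a1, a2, a12] <;> ring

theorem D2_smul {f : SA} (c : ℂ) (hf : Smooth f) : D2 (c • f) = c • D2 f := by
  ext x <;> simp [D2, dx_smul c hf, dxi2, gmul, a0, a1, a2, a12] <;> ring

variable {g : SA} (c : ℂ)

theorem Lden_eq (b : Bool) (f g : SA) (c : ℂ) :
    Lden b f c g = f ⊙ dx g + (-(sgn b * 2⁻¹)) • (D1 f ⊙ D1 g + D2 f ⊙ D2 g) + c • (dx f ⊙ g) := by
  simp only [Lden, XV]
  module

theorem D1_Lden (hf : Homog b f) (sf : Smooth f) (sg : Smooth g) :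
    D1 (Lden b f c g) = sgn b • (Lden b f (c + 2⁻¹) (D1 g) + (-2⁻¹ : ℂ) • (D1 (D2 f) ⊙ D2 g))
      + c • (D1 (dx f) ⊙ g) := by
  have s1 := sf.D1.gmul sg.D1
  have s2 := sf.D2.gmul sg.D2
  have s0 := sf.gmul sg.dx
  have s3 := sf.dx.gmul sg
  rw [Lden_eq, Lden_eq, D1_add (s0.add ((s1.add s2).smul _)) (s3.smul _),
    D1_add s0 ((s1.add s2).smul _), D1_smul _ (s1.add s2), D1_smul _ s3, D1_add s1 s2,
    D1_gmul hf sf sg.dx, D1_gmul hf.D1 sf.D1 sg.D1, D1_gmul hf.D2 sf.D2 sg.D2,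
    D1_gmul hf.dx sf.dx sg, dx_D1, D2_D1 g]
  simp only [D1_D1, gmul_neg, ← neg_one_smul ℂ (dx f), smul_gmul]
  cases b <;> simp only [sgn, Bool.not_false, Bool.not_true, if_true, Bool.false_eq_true,
    if_false] <;> module

theorem D2_Lden (hf : Homog b f) (sf : Smooth f) (sg : Smooth g) :
    D2 (Lden b f c g) = sgn b • (Lden b f (c + 2⁻¹) (D2 g) + (2⁻¹ : ℂ) • (D1 (D2 f) ⊙ D1 g))
      + c • (D2 (dx f) ⊙ g) := by
  have s1 := sf.D1.gmul sg.D1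
  have s2 := sf.D2.gmul sg.D2
  have s0 := sf.gmul sg.dx
  have s3 := sf.dx.gmul sg
  rw [Lden_eq, Lden_eq, D2_add (s0.add ((s1.add s2).smul _)) (s3.smul _),
    D2_add s0 ((s1.add s2).smul _), D2_smul _ (s1.add s2), D2_smul _ s3, D2_add s1 s2,
    D2_gmul hf sf sg.dx, D2_gmul hf.D1 sf.D1 sg.D1, D2_gmul hf.D2 sf.D2 sg.D2,
    D2_gmul hf.dx sf.dx sg, dx_D2, D2_D1 g, D2_D1 f]
  simp only [D2_D2, gmul_neg, ← neg_one_smul ℂ (dx f), ← neg_one_smul ℂ (D1 (D2 f)), smul_gmul]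
  cases b <;> simp only [sgn, Bool.not_false, Bool.not_true, if_true, Bool.false_eq_true,
    if_false] <;> module

theorem dx_Lden (b : Bool) (sf : Smooth f) (sg : Smooth g) :
    dx (Lden b f c g) = Lden b f (c + 1) (dx g)
      + ((-(sgn b * 2⁻¹)) • (D1 (dx f) ⊙ D1 g + D2 (dx f) ⊙ D2 g) + c • (dx (dx f) ⊙ g)) := by
  have s1 := sf.D1.gmul sg.D1
  have s2 := sf.D2.gmul sg.D2
  have s0 := sf.gmul sg.dx
  have s3 := sf.dx.gmul sg
  rw [Lden_eq, Lden_eq, dx_add (s0.add ((s1.add s2).smul _)) (s3.smul _),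
    dx_add s0 ((s1.add s2).smul _), dx_smul _ (s1.add s2), dx_smul _ s3, dx_add s1 s2,
    dx_gmul sf sg.dx, dx_gmul sf.D1 sg.D1, dx_gmul sf.D2 sg.D2, dx_gmul sf.dx sg]
  simp only [dx_D1, dx_D2]
  module

/-- The Leibniz rule for the action of a contact vector field on products of densities. -/
theorem Lden_gmul {bF : Bool} {F u : SA} (hf : Homog b f) (hF : Homog bF F) (sF : Smooth F)
    (su : Smooth u) (c d : ℂ) :
    Lden b f c (F ⊙ u) = Lden b f (c - d) F ⊙ u + sgn2 b bF • (F ⊙ Lden b f d u) := by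
  have h0 : ∀ {b' : Bool} {p : SA}, Homog b' p → ∀ q,
      F ⊙ (p ⊙ q) = sgn2 b' bF • (p ⊙ (F ⊙ q)) := fun hp q => by
    rw [← gmul_assoc, gmul_comm hp hF, smul_gmul, gmul_assoc]
  rw [Lden_eq, Lden_eq, Lden_eq, dx_gmul sF su, D1_gmul hF sF su, D2_gmul hF sF su]
  simp only [gmul_add, gmul_smul, add_gmul, smul_gmul, gmul_assoc, h0 hf, h0 hf.D1, h0 hf.D2,
    h0 hf.dx]
  cases b <;> cases bF <;> simp only [sgn, sgn2, Bool.not_false, Bool.not_true, if_true,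
    Bool.false_eq_true, if_false, Bool.and_true, Bool.and_false] <;> module

end Contact

section Order

variable {K : ℕ} {S T : SA → SA}

theorem InD.congr (hS : InD K S) (h : ∀ g, Smooth g → T g = S g) : InD K T := by
  obtain ⟨a, ha, ha', e⟩ := hS
  exact ⟨a, ha, ha', fun g hg => (h g hg).trans (e g hg)⟩

theorem InD.add (hS : InD K S) (hT : InD K T) : InD K (fun g => S g + T g) := by
  obtain ⟨a, ha, ha', ea⟩ := hS
  obtain ⟨b, hb, hb', eb⟩ := hT
  refine ⟨fun l m n => a l m n + b l m n, fun l m n => (ha l m n).add (hb l m n),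
    fun l m n h => by simp [ha' l m n h, hb' l m n h], fun g hg => ?_⟩
  simp only [ea g hg, eb g hg, add_gmul, Finset.sum_add_distrib]

theorem InD.gmul_left {c : SA} (hc : Smooth c) (hT : InD K T) : InD K (fun g => c ⊙ T g) := by
  obtain ⟨a, ha, ha', e⟩ := hT
  refine ⟨fun l m n => c ⊙ a l m n, fun l m n => hc.gmul (ha l m n), fun l m n h => ?_,
    fun g hg => ?_⟩
  · ext x <;> simp [ha' l m n h, gmul, a0, a1, a2, a12]
  · simp only [e g hg, gmul_sum, gmul_assoc]

theorem InD.smul (c : ℂ) (hT : InD K T) : InD K (fun g => c • T g) := by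
  obtain ⟨a, ha, ha', e⟩ := hT
  refine ⟨fun l m n => c • a l m n, fun l m n => (ha l m n).smul c,
    fun l m n h => by simp [ha' l m n h], fun g hg => ?_⟩
  simp only [e g hg, smul_gmul, Finset.smul_sum]

theorem inD_zero (K : ℕ) : InD K (fun _ => 0) :=
  ⟨fun _ _ _ => 0, fun _ _ _ => smooth_zero, fun _ _ _ _ => rfl, fun g _ => by simp [zero_gmul]⟩

theorem inD_sum {ι : Type*} (s : Finset ι) (F : ι → SA → SA) (h : ∀ i, InD K (F i)) :
    InD K (fun g => ∑ i ∈ s, F i g) := by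
  classical
  induction s using Finset.induction_on with
  | empty => simpa using inD_zero K
  | insert i s hi ih => simpa only [Finset.sum_insert hi] using (h i).add ih

theorem inD_monoD {l : ℕ} {m n : Bool} (h : 2 * l + bnat m + bnat n ≤ K) {c : SA}
    (hc : Smooth c) : InD K (fun g => c ⊙ monoD l m n g) := by
  refine ⟨fun l' m' n' => if l' = l ∧ m' = m ∧ n' = n then c else 0, fun l' m' n' => ?_,
    fun l' m' n' h' => if_neg ?_, fun g _ => ?_⟩
  · dsimp only
    split_ifs
    exacts [hc, smooth_zero]
  · rintro ⟨rfl, rfl, rfl⟩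
    exact h' h
  · rw [Finset.sum_eq_single l, Fintype.sum_eq_single m, Fintype.sum_eq_single n]
    · simp
    · intro n' hn
      simp [hn, zero_gmul]
    · intro m' hm
      simp [hm, zero_gmul]
    · intro l' _ hl
      simp [hl, zero_gmul]
    · intro hl
      exact absurd (Finset.mem_range.2 (by omega)) hl

theorem InD.dx (hT : InD K T) : InD (K + 2) (fun g => dx (T g)) := by
  obtain ⟨a, ha, ha', e⟩ := hT
  have key : ∀ l m n, InD (K + 2)
      (fun g => SA.dx (a l m n) ⊙ monoD l m n g + a l m n ⊙ monoD (l + 1) m n g) := by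
    intro l m n
    by_cases h : 2 * l + bnat m + bnat n ≤ K
    · exact (inD_monoD (by omega) (ha l m n).dx).add (inD_monoD (by omega) (ha l m n))
    · refine (inD_zero _).congr fun g _ => ?_
      have hz : SA.dx (0 : SA) = 0 := by ext x <;> simp [SA.dx, a0, a1, a2, a12]
      rw [ha' l m n h, hz, zero_gmul, zero_gmul, add_zero]
  refine (inD_sum (Finset.range (K + 1)) _ fun l => inD_sum Finset.univ _ fun m =>
    inD_sum Finset.univ _ fun n => key l m n).congr fun g hg => ?_
  have hs : ∀ l m n, Smooth (a l m n ⊙ monoD l m n g) :=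
    fun l m n => (ha l m n).gmul (hg.monoD l m n)
  rw [e g hg, (dx_sum _ _ fun l => (dx_sum _ _ fun m => (dx_sum _ _ fun n => hs l m n).1).1).2]
  refine Finset.sum_congr rfl fun l _ => ?_
  rw [(dx_sum _ _ fun m => (dx_sum _ _ fun n => hs l m n).1).2]
  refine Finset.sum_congr rfl fun m _ => ?_
  rw [(dx_sum _ _ fun n => hs l m n).2]
  refine Finset.sum_congr rfl fun n _ => ?_
  rw [dx_gmul (ha l m n) (hg.monoD l m n)]
  simp only [monoD, Function.iterate_succ_apply']

end Order

section Commutator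

variable {b : Bool} {f : SA}

/-- Commuting `∂_x^l` past a contact vector field, modulo terms of lower contact order: the
weight grows by `l`. -/
theorem inD_iterate_dx_sub (sf : Smooth f) {E V W : SA → SA} {s c : ℂ} {h : SA} (sh : Smooth h)
    (sE : ∀ g, Smooth g → Smooth (E g)) (sV : ∀ g, Smooth g → Smooth (V g))
    (sW : ∀ g, Smooth g → Smooth (W g))
    (oV : ∀ l p, Smooth p → InD (2 * l + 2) (fun g => p ⊙ dx^[l] (V g)))
    (oW : ∀ l p, Smooth p → InD (2 * l + 2) (fun g => p ⊙ dx^[l] (W g)))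
    (oV1 : ∀ l p, Smooth p → InD (2 * l + 2) (fun g => p ⊙ D1 (dx^[l] (V g))))
    (oV2 : ∀ l p, Smooth p → InD (2 * l + 2) (fun g => p ⊙ D2 (dx^[l] (V g))))
    (base : InD 0 (fun g => E g - s • (Lden b f c (V g) + h ⊙ W g))) (l : ℕ) :
    InD (2 * l) (fun g => dx^[l] (E g)
      - s • (Lden b f (c + l) (dx^[l] (V g)) + h ⊙ dx^[l] (W g))) := by
  induction l with
  | zero => simpa using base
  | succ l ih =>
    have lower := (((((oV1 l _ sf.dx.D1).add (oV2 l _ sf.dx.D2)).smul (-(sgn b * 2⁻¹))).add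
      ((oV l _ sf.dx.dx).smul (c + l))).add (oW l _ sh.dx)).smul s
    refine (ih.dx.add lower).congr fun g hg => ?_
    have v := (sV g hg).iterate_dx l
    have w := (sW g hg).iterate_dx l
    have L := Smooth.Lden b (c + l) sf v
    rw [dx_sub ((sE g hg).iterate_dx l) ((L.add (sh.gmul w)).smul s),
      dx_smul s (L.add (sh.gmul w)), dx_add L (sh.gmul w), dx_gmul sh w, dx_Lden _ _ sf v,
      ← Function.iterate_succ_apply' dx, ← Function.iterate_succ_apply' dx,
      ← Function.iterate_succ_apply' dx]
    push_cast
    rw [← add_assoc]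
    module

theorem inD_dx_D1_Lden (hf : Homog b f) (sf : Smooth f) (c : ℂ) (l : ℕ) :
    InD (2 * l) (fun g => dx^[l] (D1 (Lden b f c g))
      - sgn b • (Lden b f (c + 2⁻¹ + l) (dx^[l] (D1 g))
        + ((-2⁻¹ : ℂ) • D1 (D2 f)) ⊙ dx^[l] (D2 g))) := by
  refine inD_iterate_dx_sub sf (sf.D2.D1.smul _) (fun g hg => (Smooth.Lden b c sf hg).D1)
    (fun g hg => hg.D1) (fun g hg => hg.D2) (fun l p hp => ?_) (fun l p hp => ?_)
    (fun l p hp => ?_) (fun l p hp => ?_) ?_ l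
  · exact (inD_monoD (l := l) (m := true) (n := false) (by simp [bnat]) hp)
  · exact (inD_monoD (l := l) (m := false) (n := true) (by simp [bnat]) hp)
  · refine ((inD_monoD (l := l + 1) (m := false) (n := false) (by simp [bnat]; omega) hp).smul
      (-1)).congr fun g _ => ?_
    rw [← iterate_dx_D1, D1_D1, iterate_dx_neg, gmul_neg, neg_one_smul]
    rfl
  · refine ((inD_monoD (l := l) (m := true) (n := true) (by simp [bnat]) hp).smul
      (-1)).congr fun g _ => ?_
    rw [← iterate_dx_D2, D2_D1, iterate_dx_neg, gmul_neg, neg_one_smul]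
    rfl
  · refine ((inD_monoD (l := 0) (m := false) (n := false) (by simp [bnat]) sf.dx.D1).smul
      c).congr fun g hg => ?_
    rw [D1_Lden c hf sf hg, smul_gmul, add_sub_cancel_left]
    rfl

theorem inD_dx_D2_Lden (hf : Homog b f) (sf : Smooth f) (c : ℂ) (l : ℕ) :
    InD (2 * l) (fun g => dx^[l] (D2 (Lden b f c g))
      - sgn b • (Lden b f (c + 2⁻¹ + l) (dx^[l] (D2 g))
        + ((2⁻¹ : ℂ) • D1 (D2 f)) ⊙ dx^[l] (D1 g))) := by
  refine inD_iterate_dx_sub sf (sf.D2.D1.smul _) (fun g hg => (Smooth.Lden b c sf hg).D2)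
    (fun g hg => hg.D2) (fun g hg => hg.D1) (fun l p hp => ?_) (fun l p hp => ?_)
    (fun l p hp => ?_) (fun l p hp => ?_) ?_ l
  · exact (inD_monoD (l := l) (m := false) (n := true) (by simp [bnat]) hp)
  · exact (inD_monoD (l := l) (m := true) (n := false) (by simp [bnat]) hp)
  · refine (inD_monoD (l := l) (m := true) (n := true) (by simp [bnat]) hp).congr fun g _ => ?_
    rw [← iterate_dx_D1]
    rfl
  · refine ((inD_monoD (l := l + 1) (m := false) (n := false) (by simp [bnat]; omega) hp).smul
      (-1)).congr fun g _ => ?_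
    rw [← iterate_dx_D2, D2_D2, iterate_dx_neg, gmul_neg, neg_one_smul]
    rfl
  · refine ((inD_monoD (l := 0) (m := false) (n := false) (by simp [bnat]) sf.dx.D2).smul
      c).congr fun g hg => ?_
    rw [D2_Lden c hf sf hg, smul_gmul, add_sub_cancel_left]
    rfl

end Commutator

end SA

/-- Action on principal symbols of half-integer contact order
`k = ℓ + 1/2`: for a homogeneous `f` and a homogeneous symbol `(F₁,F₂)`,
`𝓛_{X_f}(F₁∂_x^ℓD̄₁ + F₂∂_x^ℓD̄₂)` equals
`(L^{μ-λ-k}F₁ - ½D̄₁D̄₂(f)F₂)∂_x^ℓD̄₁ + (L^{μ-λ-k}F₂ + ½D̄₁D̄₂(f)F₁)∂_x^ℓD̄₂`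
modulo `D^{k-1/2}_{λμ}`: the action mixes the two components via the term
`½D̄₁D̄₂(f)`. -/
theorem statement8 :
    ∀ (l : ℕ) (lam mu : ℂ) (bf bF : Bool) (f F1 F2 : SA),
      Smooth f → Smooth F1 → Smooth F2 →
      Homog bf f → Homog bF F1 → Homog bF F2 →
      InD (2 * l) (fun g =>
        LieD bf f lam mu (!bF)
          (fun u => F1 ⊙ dx^[l] (D1 u) + F2 ⊙ dx^[l] (D2 u)) g
        - ((Lden bf f (mu - lam - (l : ℂ) - 2⁻¹) F1 - (2 : ℂ)⁻¹ • (D1 (D2 f) ⊙ F2))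
              ⊙ dx^[l] (D1 g)
           + (Lden bf f (mu - lam - (l : ℂ) - 2⁻¹) F2 + (2 : ℂ)⁻¹ • (D1 (D2 f) ⊙ F1))
              ⊙ dx^[l] (D2 g))) := by
  intro l lam mu b bF f F1 F2 sf s1 s2 hf h1 h2
  have hDD : Homog b (D1 (D2 f)) := by simpa using hf.D2.D1
  refine ((((inD_dx_D1_Lden hf sf lam l).gmul_left s1).add
    ((inD_dx_D2_Lden hf sf lam l).gmul_left s2)).smul (-sgn2 b (!bF))).congr fun g hg => ?_
  have u1 := hg.D1.iterate_dx l
  have u2 := hg.D2.iterate_dx l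
  have e : mu - lam - (l : ℂ) - 2⁻¹ = mu - (lam + 2⁻¹ + l) := by ring
  have hL : Lden b f mu (F1 ⊙ dx^[l] (D1 g) + F2 ⊙ dx^[l] (D2 g))
      = Lden b f mu (F1 ⊙ dx^[l] (D1 g)) + Lden b f mu (F2 ⊙ dx^[l] (D2 g)) := by
    have v1 := s1.gmul u1
    have v2 := s2.gmul u2
    simp only [Lden_eq, dx_add v1 v2, D1_add v1 v2, D2_add v1 v2, gmul_add]
    module
  simp only [LieD]
  rw [hL, Lden_gmul hf h1 s1 u1 mu (lam + 2⁻¹ + l), Lden_gmul hf h2 s2 u2 mu (lam + 2⁻¹ + l), e]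
  simp only [gmul_sub, gmul_add, gmul_smul, smul_gmul, sub_gmul, add_gmul, ← gmul_assoc,
    gmul_comm hDD h1, gmul_comm hDD h2]
  cases b <;> cases bF <;> simp only [sgn, sgn2, Bool.not_false, Bool.not_true, if_true,
    Bool.false_eq_true, if_false, Bool.and_true, Bool.and_false] <;> module
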